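/- Let N ≥ 1 be an integer and let m_{2p} = ∫_ℝ x^{2p}·ρ_N(x) dx denote the even moments of the unscaled GUE eigenvalue density. Then for every real s with 0 < |s| < 1, the series Σ_{p=0}^{∞} (s^{2p}/(2p−1)!!)·m_{2p} converges and equals (1/(2s²))·( ((1+s²)/(1−s²))^N − 1 ), where (2p−1)!! = (2p)!/(2^p·p!) and (−1)!! = 1. -/

import Mathlib

open Nat MeasureTheory

/-- The orthonormal Hermite functions' polynomial part:
`p_n(x) = He_n(x)/√(√(2π)·n!)`, orthonormal for the weight `e^{-x²/2}` on `ℝ`. -/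
noncomputable def pOrtho (n : ℕ) (x : ℝ) : ℝ :=
  Polynomial.aeval x (Polynomial.hermite n) /
    Real.sqrt (Real.sqrt (2 * Real.pi) * (n ! : ℝ))

/-- The (unscaled) GUE eigenvalue density
`ρ_N(x) = √N · e^{-x²/2} · (p_N'(x)p_{N-1}(x) − p_N(x)p_{N-1}'(x))`. -/
noncomputable def gueDensity (N : ℕ) (x : ℝ) : ℝ :=
  Real.sqrt N * Real.exp (-x ^ 2 / 2) *
    (deriv (pOrtho N) x * pOrtho (N - 1) x - pOrtho N x * deriv (pOrtho (N - 1)) x)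

/-- The even moments `m_{2p} = ∫_ℝ x^{2p} ρ_N(x) dx` of the unscaled GUE
eigenvalue density. -/
noncomputable def gueMoment (N p : ℕ) : ℝ :=
  ∫ x : ℝ, x ^ (2 * p) * gueDensity N x


open Polynomial in
/-- The Hermite polynomials `He_n`, with real coefficients. -/
noncomputable def realHermite (n : ℕ) : ℝ[X] :=
  (hermite n).map (Int.castRingHom ℝ)

section Hermite

open Polynomial

theorem realHermite_zero : realHermite 0 = 1 := by
  simp [realHermite]

theorem realHermite_succ (n : ℕ) :
    realHermite (n + 1) = X * realHermite n - derivative (realHermite n) := by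
  simp [realHermite, hermite_succ, derivative_map]

theorem derivative_realHermite_succ (n : ℕ) :
    derivative (realHermite (n + 1)) = ((n + 1 : ℕ) : ℝ[X]) * realHermite n := by
  induction n with
  | zero => simp [realHermite_succ, realHermite_zero]
  | succ n ih =>
    rw [realHermite_succ (n + 1), derivative_sub, derivative_mul, ih, derivative_X,
      derivative_natCast_mul, realHermite_succ n]
    push_cast
    ring

theorem iterate_derivative_realHermite (i j : ℕ) :
    derivative^[j] (realHermite (i + j)) = ((i + j).descFactorial j : ℝ[X]) * realHermite i := by
  induction j with
  | zero => simp
  | succ j ih =>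
    rw [Function.iterate_succ_apply, ← add_assoc, derivative_realHermite_succ,
      iterate_derivative_natCast_mul, ih, Nat.succ_descFactorial_succ]
    push_cast
    ring

theorem realHermite_christoffelDarboux (n : ℕ) :
    derivative (realHermite (n + 1)) * realHermite n
        - realHermite (n + 1) * derivative (realHermite n) =
      ∑ k ∈ Finset.range (n + 1), C ((n ! : ℝ) / k !) * realHermite k ^ 2 := by
  induction n with
  | zero => simp [realHermite_succ, realHermite_zero]
  | succ n ih =>
    have hsum : ∑ k ∈ Finset.range (n + 1), C (((n + 1)! : ℝ) / k !) * realHermite k ^ 2 =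
        ((n + 1 : ℕ) : ℝ[X]) *
          ∑ k ∈ Finset.range (n + 1), C ((n ! : ℝ) / k !) * realHermite k ^ 2 := by
      rw [Finset.mul_sum]
      refine Finset.sum_congr rfl fun k _ => ?_
      rw [Nat.factorial_succ, Nat.cast_mul, mul_div_assoc, C_mul, C_eq_natCast, mul_assoc]
    rw [Finset.sum_range_succ, hsum, ← ih, div_self (by positivity), C_1,
      realHermite_succ (n + 1), derivative_sub, derivative_mul, derivative_X,
      derivative_realHermite_succ, derivative_natCast_mul]
    ring

end Hermite

section GaussianIntegral

open Polynomial

theorem integrable_eval_mul_gaussian (f : ℝ[X]) :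
    Integrable fun x : ℝ => f.eval x * Real.exp (-x ^ 2 / 2) := by
  induction f using Polynomial.induction_on' with
  | add f g hf hg => simpa only [eval_add, add_mul] using! hf.add hg
  | monomial n a =>
    have h := (integrable_rpow_mul_exp_neg_mul_sq (b := 1 / 2) (by norm_num)
      (s := n) (by linarith [(n.cast_nonneg : (0 : ℝ) ≤ n)])).const_mul a
    refine h.congr (Filter.Eventually.of_forall fun x => ?_)
    simp only [eval_monomial, Real.rpow_natCast]
    ring_nf

/-- Integration of real polynomials against the weight `e^{-x²/2}`. -/
noncomputable def gaussianFunctional : ℝ[X] →ₗ[ℝ] ℝ where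
  toFun f := ∫ x : ℝ, f.eval x * Real.exp (-x ^ 2 / 2)
  map_add' f g := by
    simp only [eval_add, add_mul]
    exact integral_add (integrable_eval_mul_gaussian f) (integrable_eval_mul_gaussian g)
  map_smul' c f := by
    simp only [eval_smul, smul_eq_mul, mul_assoc, integral_const_mul, RingHom.id_apply]

theorem gaussianFunctional_apply (f : ℝ[X]) :
    gaussianFunctional f = ∫ x : ℝ, f.eval x * Real.exp (-x ^ 2 / 2) := rfl

theorem gaussianFunctional_natCast_mul (n : ℕ) (f : ℝ[X]) :
    gaussianFunctional ((n : ℝ[X]) * f) = n * gaussianFunctional f := by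
  rw [← nsmul_eq_mul, map_nsmul, nsmul_eq_mul]

theorem gaussianFunctional_X_mul (f : ℝ[X]) :
    gaussianFunctional (X * f) = gaussianFunctional (derivative f) := by
  have h : ∫ x : ℝ, (derivative f - X * f).eval x * Real.exp (-x ^ 2 / 2) = 0 := by
    refine integral_eq_zero_of_hasDerivAt_of_integrable (fun x => ?_)
      (integrable_eval_mul_gaussian _) (integrable_eval_mul_gaussian f)
    have hexp : HasDerivAt (fun x : ℝ => Real.exp (-x ^ 2 / 2))
        (Real.exp (-x ^ 2 / 2) * -x) x := by
      refine HasDerivAt.exp ?_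
      convert! ((hasDerivAt_pow 2 x).neg.div_const 2) using 1
      norm_num
      ring
    convert! (f.hasDerivAt x).mul hexp using 1
    simp only [eval_sub, eval_mul, eval_X]
    ring
  rw [← gaussianFunctional_apply, map_sub] at h
  linarith

theorem gaussianFunctional_one : gaussianFunctional 1 = √(2 * Real.pi) := by
  have h := integral_gaussian (1 / 2)
  rw [show Real.pi / (1 / 2) = 2 * Real.pi by ring] at h
  rw [gaussianFunctional_apply, ← h]
  congr 1 with x
  simp only [eval_one, one_mul]
  ring_nf

theorem gaussianFunctional_X_pow_two_mul (p : ℕ) :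
    gaussianFunctional (X ^ (2 * p)) = √(2 * Real.pi) * (((2 * p)! : ℝ) / (2 ^ p * p !)) := by
  induction p with
  | zero => simp [gaussianFunctional_one]
  | succ p ih =>
    rw [show 2 * (p + 1) = 2 * p + 1 + 1 by ring, _root_.pow_succ', gaussianFunctional_X_mul,
      derivative_X_pow, C_eq_natCast, gaussianFunctional_natCast_mul, Nat.add_sub_cancel, ih,
      Nat.factorial_succ (2 * p + 1), Nat.factorial_succ (2 * p), Nat.factorial_succ p]
    push_cast
    field_simp
    ring

theorem gaussianFunctional_mul_realHermite (n : ℕ) (f : ℝ[X]) :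
    gaussianFunctional (f * realHermite n) = gaussianFunctional (derivative^[n] f) := by
  induction n generalizing f with
  | zero => simp [realHermite_zero]
  | succ n ih =>
    rw [realHermite_succ, Function.iterate_succ_apply, ← ih, mul_sub, mul_left_comm, map_sub,
      gaussianFunctional_X_mul, derivative_mul, map_add, add_sub_cancel_right]

theorem gaussianFunctional_X_pow_mul_realHermite (m i : ℕ) :
    gaussianFunctional (X ^ m * realHermite i) =
      m.descFactorial i * gaussianFunctional (X ^ (m - i)) := by
  rw [gaussianFunctional_mul_realHermite, iterate_derivative_X_pow_eq_natCast_mul,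
    gaussianFunctional_natCast_mul]

theorem descFactorial_mul_gaussianFunctional (p i : ℕ) :
    ((2 * p).descFactorial i : ℝ) * gaussianFunctional (X ^ (2 * p - i) * realHermite i) =
      √(2 * Real.pi) * (((2 * p)! : ℝ) / (2 ^ p * p !)) * (i ! * p.choose i * 2 ^ i) := by
  rw [gaussianFunctional_X_pow_mul_realHermite]
  rcases le_or_gt i p with hip | hip
  · obtain ⟨j, rfl⟩ := Nat.exists_eq_add_of_le hip
    rw [show 2 * (i + j) - i - i = 2 * j by omega, gaussianFunctional_X_pow_two_mul]
    have h1 := Nat.factorial_mul_descFactorial (n := 2 * (i + j)) (k := i) (by omega)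
    have h2 := Nat.factorial_mul_descFactorial (n := 2 * (i + j) - i) (k := i) (by omega)
    have h3 := Nat.add_choose_mul_factorial_mul_factorial i j
    rw [← Nat.choose_symm_add] at h3
    rw [show 2 * (i + j) - i - i = 2 * j by omega] at h2
    rw [← h1, ← h2, ← h3]
    have : 0 < (i + j).choose i := Nat.choose_pos hip
    push_cast
    field_simp
    ring
  · rw [Nat.choose_eq_zero_of_lt hip,
      Nat.descFactorial_eq_zero_iff_lt.2 (show 2 * p - i < i by omega)]
    simp

theorem gaussianFunctional_X_pow_mul_realHermite_sq (p k : ℕ) :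
    gaussianFunctional (X ^ (2 * p) * realHermite k ^ 2) =
      √(2 * Real.pi) * (((2 * p)! : ℝ) / (2 ^ p * p !)) * k ! *
        ∑ i ∈ Finset.range (k + 1), (k.choose i : ℝ) * p.choose i * 2 ^ i := by
  rw [show (X : ℝ[X]) ^ (2 * p) * realHermite k ^ 2 =
      realHermite k * X ^ (2 * p) * realHermite k by ring,
    gaussianFunctional_mul_realHermite, iterate_derivative_mul, map_sum, Finset.mul_sum]
  refine Finset.sum_congr rfl fun i hi => ?_
  obtain ⟨j, rfl⟩ := Nat.exists_eq_add_of_le (Nat.lt_succ_iff.1 (Finset.mem_range.1 hi))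
  have hfac := Nat.factorial_mul_descFactorial (n := i + j) (k := j) (by omega)
  rw [Nat.add_sub_cancel] at hfac
  rw [Nat.add_sub_cancel_left, iterate_derivative_realHermite,
    iterate_derivative_X_pow_eq_natCast_mul, map_nsmul, nsmul_eq_mul,
    show ((i + j).descFactorial j : ℝ[X]) * realHermite i *
        (((2 * p).descFactorial i : ℝ[X]) * X ^ (2 * p - i)) =
      ((i + j).descFactorial j : ℝ[X]) * (((2 * p).descFactorial i : ℝ[X]) *
        (X ^ (2 * p - i) * realHermite i)) by ring,
    gaussianFunctional_natCast_mul, gaussianFunctional_natCast_mul,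
    descFactorial_mul_gaussianFunctional, ← hfac]
  push_cast
  ring

end GaussianIntegral

theorem pOrtho_eq_eval (n : ℕ) :
    pOrtho n = fun x => (realHermite n).eval x / √(√(2 * Real.pi) * (n ! : ℝ)) := by
  ext x
  rw [pOrtho, realHermite, Polynomial.eval_map, Polynomial.aeval_def]
  rfl

theorem deriv_pOrtho (n : ℕ) (x : ℝ) :
    deriv (pOrtho n) x =
      (Polynomial.derivative (realHermite n)).eval x / √(√(2 * Real.pi) * (n ! : ℝ)) := by
  rw [pOrtho_eq_eval, deriv_div_const, Polynomial.deriv]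

theorem gueDensity_succ (n : ℕ) (x : ℝ) :
    gueDensity (n + 1) x = (√(2 * Real.pi) * n !)⁻¹ *
      ((∑ k ∈ Finset.range (n + 1),
        Polynomial.C ((n ! : ℝ) / k !) * realHermite k ^ 2).eval x * Real.exp (-x ^ 2 / 2)) := by
  have hc : √((n + 1 : ℕ) : ℝ) / (√(√(2 * Real.pi) * ((n + 1)! : ℝ)) *
      √(√(2 * Real.pi) * (n ! : ℝ))) = (√(2 * Real.pi) * n !)⁻¹ := by
    have hsplit : √(√(2 * Real.pi) * ((n + 1)! : ℝ)) =
        √((n + 1 : ℕ) : ℝ) * √(√(2 * Real.pi) * (n ! : ℝ)) := by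
      rw [← Real.sqrt_mul (by positivity), Nat.factorial_succ]
      push_cast
      ring_nf
    rw [hsplit, mul_assoc, Real.mul_self_sqrt (by positivity)]
    have : √((n + 1 : ℕ) : ℝ) ≠ 0 := by positivity
    field_simp
  rw [gueDensity, Nat.add_sub_cancel, deriv_pOrtho, deriv_pOrtho, pOrtho_eq_eval, pOrtho_eq_eval,
    ← realHermite_christoffelDarboux, ← hc, Polynomial.eval_sub, Polynomial.eval_mul,
    Polynomial.eval_mul]
  ring

theorem gueMoment_eq (N p : ℕ) (hN : 1 ≤ N) :
    gueMoment N p = ((2 * p)! : ℝ) / (2 ^ p * p !) *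
      ∑ k ∈ Finset.range N, ∑ i ∈ Finset.range (k + 1),
        (k.choose i : ℝ) * p.choose i * 2 ^ i := by
  obtain ⟨n, rfl⟩ := Nat.exists_eq_add_of_le' hN
  have h : gueMoment (n + 1) p = (√(2 * Real.pi) * n !)⁻¹ *
      gaussianFunctional (∑ k ∈ Finset.range (n + 1),
        ((n ! : ℝ) / k !) • (Polynomial.X ^ (2 * p) * realHermite k ^ 2)) := by
    rw [gaussianFunctional_apply, ← integral_const_mul, gueMoment]
    congr 1 with x
    rw [gueDensity_succ, Polynomial.eval_finsetSum, Polynomial.eval_finsetSum]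
    simp only [Polynomial.eval_mul, Polynomial.eval_C, Polynomial.eval_pow, Polynomial.eval_X,
      Polynomial.eval_smul, smul_eq_mul, mul_left_comm _ (x ^ (2 * p)), ← Finset.mul_sum]
    ring
  rw [h, map_sum, Finset.mul_sum, Finset.mul_sum]
  refine Finset.sum_congr rfl fun k _ => ?_
  rw [map_smul, gaussianFunctional_X_pow_mul_realHermite_sq, smul_eq_mul]
  have : √(2 * Real.pi) ≠ 0 := by positivity
  field_simp

theorem hasSum_pow_mul_choose (i : ℕ) {t : ℝ} (ht : |t| < 1) :
    HasSum (fun p : ℕ => t ^ p * (p.choose i : ℝ)) (t ^ i / (1 - t) ^ (i + 1)) := by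
  rw [← hasSum_nat_add_iff' i, Finset.sum_eq_zero (fun p hp => by
    rw [Nat.choose_eq_zero_of_lt (Finset.mem_range.1 hp), Nat.cast_zero, mul_zero]), sub_zero]
  have h := (hasSum_choose_mul_geometric_of_norm_lt_one i (r := t) ht).mul_left (t ^ i)
  rw [mul_one_div] at h
  refine h.congr_fun fun p => ?_
  rw [pow_add]
  ring

/-- The generating function of a row of Delannoy numbers. -/
theorem hasSum_pow_mul_delannoy (k : ℕ) {t : ℝ} (ht : |t| < 1) :
    HasSum (fun p : ℕ => t ^ p * ∑ i ∈ Finset.range (k + 1),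
        (k.choose i : ℝ) * p.choose i * 2 ^ i)
      (((1 + t) / (1 - t)) ^ k / (1 - t)) := by
  have ht1 : 1 - t ≠ 0 := by linarith [(abs_lt.1 ht).2]
  have h := hasSum_sum fun i (_ : i ∈ Finset.range (k + 1)) =>
    (hasSum_pow_mul_choose i ht).mul_left ((k.choose i : ℝ) * 2 ^ i)
  convert! h using 1
  · ext p
    rw [Finset.mul_sum]
    exact Finset.sum_congr rfl fun i _ => by ring
  · rw [show (1 + t) / (1 - t) = 2 * t / (1 - t) + 1 by field_simp; ring, add_pow,
      Finset.sum_div]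
    refine Finset.sum_congr rfl fun i _ => ?_
    rw [div_pow, mul_pow, one_pow, pow_succ]
    field_simp

/-- The Harer–Zagier generating function identity: for `0 < |s| < 1`,
`∑_{p≥0} s^{2p} m_{2p}/(2p−1)!! = (1/(2s²))·(((1+s²)/(1−s²))^N − 1)`, where
`(2p−1)!! = (2p)!/(2^p p!)`. -/
theorem gueMoment_harer_zagier (N : ℕ) (hN : 1 ≤ N) (s : ℝ)
    (hs0 : 0 < |s|) (hs1 : |s| < 1) :
    Summable (fun p : ℕ =>
      s ^ (2 * p) / (((2 * p)! : ℝ) / (2 ^ p * (p ! : ℝ))) * gueMoment N p) ∧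
    ∑' p : ℕ, s ^ (2 * p) / (((2 * p)! : ℝ) / (2 ^ p * (p ! : ℝ))) * gueMoment N p =
      1 / (2 * s ^ 2) * (((1 + s ^ 2) / (1 - s ^ 2)) ^ N - 1) := by
  have hs : 0 < s ^ 2 := by rw [← sq_abs]; positivity
  have hs_lt : s ^ 2 < 1 := by rw [← sq_abs]; nlinarith
  have ht : |s ^ 2| < 1 := by rwa [abs_of_pos hs]
  have h1 : 1 - s ^ 2 ≠ 0 := by linarith
  have key := hasSum_sum fun k (_ : k ∈ Finset.range N) => hasSum_pow_mul_delannoy k ht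
  have hratio : (1 + s ^ 2) / (1 - s ^ 2) - 1 = 2 * s ^ 2 / (1 - s ^ 2) := by
    field_simp
    ring
  have hne : (1 + s ^ 2) / (1 - s ^ 2) ≠ 1 := by
    rw [← sub_ne_zero, hratio]
    positivity
  have hval : ∑ k ∈ Finset.range N, ((1 + s ^ 2) / (1 - s ^ 2)) ^ k / (1 - s ^ 2) =
      1 / (2 * s ^ 2) * (((1 + s ^ 2) / (1 - s ^ 2)) ^ N - 1) := by
    rw [← Finset.sum_div, geom_sum_eq hne, hratio]
    field_simp
  have hterm : (fun p : ℕ => s ^ (2 * p) / (((2 * p)! : ℝ) / (2 ^ p * (p ! : ℝ))) *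
      gueMoment N p) = fun p => ∑ k ∈ Finset.range N, (s ^ 2) ^ p *
        ∑ i ∈ Finset.range (k + 1), (k.choose i : ℝ) * p.choose i * 2 ^ i := by
    ext p
    rw [gueMoment_eq N p hN, pow_mul, ← Finset.mul_sum, ← mul_assoc,
      div_mul_cancel₀ _ (by positivity)]
  rw [hterm, ← hval]
  exact ⟨key.summable, key.tsum_eq⟩
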